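/- arXiv:math/0111005 — 2 statements merged into one kernel-verified Lean document; each statement's English description precedes it below -/
import Mathlib

section
/- Let R ⊆ S be Noetherian domains (not necessarily commutative) such that S is a simple ring and S is finitely generated both as a left and as a right R-module. If R and S have the same skew field of fractions, then R = S. -/
/-- The elements `w` such that no nonzero homomorphism to `X` is defined on a submodule of the
cyclic module generated by the image of `w` modulo `L`. -/
def rationalClosure {R X : Type*} [Ring R] [AddCommGroup X] [Module R X]
    (L : Submodule R X) : Submodule R X where
  carrier := {w | ∀ (s : R) (x : X), (∀ r : R, r • s • w ∈ L → r • x = 0) → x = 0}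
  zero_mem' := fun s x h => by simpa using h 1 (by simp)
  add_mem' := by
    intro w₁ w₂ h₁ h₂ s x h
    refine h₁ s x fun r hr => h₂ (r * s) (r • x) fun r' hr' => ?_
    rw [← mul_smul]
    refine h _ ?_
    rw [smul_add, smul_add]
    refine L.add_mem ?_ ?_
    · rw [mul_smul]
      exact L.smul_mem _ hr
    · rwa [mul_smul, ← mul_smul r s]
  smul_mem' := by
    intro c w h s x hx
    refine h (s * c) x fun r hr => hx r ?_
    rwa [← mul_smul s c]

/-- A submodule `U` of `X` all of whose proper quotients admit no nonzero partial homomorphism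
to `X`. -/
def IsCriticalSubmodule {R X : Type*} [Ring R] [AddCommGroup X] [Module R X]
    (U : Submodule R X) : Prop :=
  ∀ L ≤ U, L ≠ ⊥ → U ≤ rationalClosure L

/-- The sum of all critical submodules. -/
def criticalSocle (R X : Type*) [Ring R] [AddCommGroup X] [Module R X] : Submodule R X :=
  sSup {U | IsCriticalSubmodule U}

section Modules

variable {R X : Type*} [Ring R] [AddCommGroup X] [Module R X]

theorem rationalClosure_mono {L L' : Submodule R X} (h : L ≤ L') :
    rationalClosure L ≤ rationalClosure L' :=
  fun _ hw s x hx => hw s x fun r hr => hx r (h hr)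

theorem exists_isCriticalSubmodule_ne_bot [IsNoetherian R X] [Nontrivial X] :
    ∃ U : Submodule R X, IsCriticalSubmodule U ∧ U ≠ ⊥ := by
  obtain ⟨x₀, hx₀⟩ := exists_ne (0 : X)
  obtain ⟨L, ⟨v, x, hx, hvx⟩, hmax⟩ := WellFounded.has_min
    (wellFounded_gt : WellFounded ((· > ·) : Submodule R X → Submodule R X → Prop))
    {L | ∃ v x : X, x ≠ 0 ∧ ∀ r : R, r • v ∈ L → r • x = 0}
    ⟨⊥, x₀, x₀, hx₀, fun r hr => by simpa using hr⟩
  refine ⟨Submodule.span R {x}, ?_, by simpa using hx⟩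
  intro L' hL' hne u hu s y hy
  by_contra hy0
  obtain ⟨z, hz, hz0⟩ := L'.ne_bot_iff.1 hne
  obtain ⟨a, rfl⟩ := Submodule.mem_span_singleton.1 (hL' hz)
  obtain ⟨b, rfl⟩ := Submodule.mem_span_singleton.1 hu
  let φ := LinearMap.toSpanSingleton R X v
  let ψ := LinearMap.toSpanSingleton R X x
  refine hmax (L ⊔ (L'.comap ψ).map φ) ⟨(s * b) • v, y, hy0, fun r hr => ?_⟩ ?_
  · obtain ⟨l, hl, _, ⟨c, hc, rfl⟩, hlc⟩ := Submodule.mem_sup.1 hr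
    refine hy r ?_
    have h1 : (r * (s * b) - c) • v ∈ L := by
      have : (r * (s * b) - c) • v = l := by
        rw [sub_smul, mul_smul, ← hlc]
        simp [φ]
      rwa [this]
    have h2 := hvx _ h1
    rw [sub_smul, sub_eq_zero] at h2
    rw [← mul_smul s, ← mul_smul, h2]
    simpa [ψ] using hc
  · refine lt_of_le_of_ne le_sup_left fun h => hz0 (hvx a ?_)
    rw [h]
    exact Submodule.mem_sup_right ⟨a, by simpa [ψ] using hz, by simp [φ]⟩

theorem criticalSocle_ne_bot [IsNoetherian R X] [Nontrivial X] : criticalSocle R X ≠ ⊥ := by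
  obtain ⟨U, hU, hne⟩ := exists_isCriticalSubmodule_ne_bot (R := R) (X := X)
  exact ne_bot_of_le_ne_bot hne (le_sSup hU)

theorem IsCriticalSubmodule.map {U : Submodule R X} (hU : IsCriticalSubmodule U)
    (g : X →ₗ[R] X) : IsCriticalSubmodule (U.map g) := by
  rintro L' hL' hne _ ⟨u, hu, rfl⟩ s y hy
  refine hU (U ⊓ L'.comap g) inf_le_left ?_ hu s y fun r hr => hy r ?_
  · obtain ⟨z, hz, hz0⟩ := L'.ne_bot_iff.1 hne
    obtain ⟨w, hw, rfl⟩ := hL' hz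
    refine (Submodule.ne_bot_iff _).2 ⟨w, ⟨hw, hz⟩, ?_⟩
    rintro rfl
    simp at hz0
  · simpa using hr.2

theorem map_mem_criticalSocle (g : X →ₗ[R] X) {x : X} (hx : x ∈ criticalSocle R X) :
    g x ∈ criticalSocle R X := by
  have : criticalSocle R X ≤ (criticalSocle R X).comap g :=
    sSup_le fun U hU => Submodule.map_le_iff_le_comap.1 (le_sSup (hU.map g))
  exact this hx

theorem criticalSocle_le_rationalClosure {E : Submodule R X}
    (hE : ∀ V : Submodule R X, Disjoint V E → V = ⊥) :
    criticalSocle R X ≤ rationalClosure E := by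
  refine sSup_le fun U hU => ?_
  by_cases h : U ⊓ E = ⊥
  · rw [hE U (disjoint_iff.2 h)]
    exact bot_le
  · exact (hU _ inf_le_left h).trans (rationalClosure_mono inf_le_right)

/-- Inside the critical socle, essential extensions are rational. -/
theorem le_rationalClosure_of_essential [IsNoetherian R X] {L L' : Submodule R X}
    (hLL' : L ≤ L') (hL' : L' ≤ criticalSocle R X)
    (hess : ∀ V ≤ L', Disjoint V L → V = ⊥) : L' ≤ rationalClosure L := by
  obtain ⟨W, hW, hmax⟩ := WellFounded.has_min
    (wellFounded_gt : WellFounded ((· > ·) : Submodule R X → Submodule R X → Prop))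
    {W | Disjoint W L'} ⟨⊥, disjoint_bot_left⟩
  have hE : ∀ V : Submodule R X, Disjoint V (L ⊔ W) → V = ⊥ := by
    intro V hV
    have h1 : Disjoint (V ⊔ W) L := by
      rw [Submodule.disjoint_def]
      intro x hx hxL
      obtain ⟨v, hv, w, hw, rfl⟩ := Submodule.mem_sup.1 hx
      have hv0 : v = 0 := by
        refine Submodule.disjoint_def.1 hV v hv ?_
        have : v = (v + w) - w := by abel
        rw [this]
        exact sub_mem (Submodule.mem_sup_left hxL) (Submodule.mem_sup_right hw)
      subst hv0
      rw [zero_add] at hxL ⊢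
      exact Submodule.disjoint_def.1 hW w hw (hLL' hxL)
    have h2 : (V ⊔ W) ⊓ L' = ⊥ := hess _ inf_le_right (h1.mono_left inf_le_left)
    have h3 : V ≤ W := by
      by_contra h
      exact hmax (V ⊔ W) (disjoint_iff.2 h2)
        (lt_of_le_of_ne le_sup_right fun h' => h (h' ▸ le_sup_left))
    exact disjoint_self.1 (hV.mono_right (h3.trans le_sup_right))
  intro w hw s x hx
  refine criticalSocle_le_rationalClosure hE (hL' hw) s x fun r hr => hx r ?_
  obtain ⟨l, hl, w', hw', h⟩ := Submodule.mem_sup.1 hr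
  have hw0 : w' = 0 := by
    refine Submodule.disjoint_def.1 hW w' hw' ?_
    have : w' = r • s • w - l := by rw [← h]; abel
    rw [this]
    exact sub_mem (L'.smul_mem _ (L'.smul_mem _ hw)) (hLL' hl)
  rw [← h, hw0, add_zero]
  exact hl

end Modules

section Action

variable {R X S : Type*} [Ring R] [AddCommGroup X] [Module R X] [IsNoetherian R X]
  [Ring S] [IsDomain S]

theorem exists_injective_on_range (ρ : S → X →ₗ[R] X)
    (hmul : ∀ s t x, ρ (s * t) x = ρ t (ρ s x)) :
    ∃ s : S, s ≠ 0 ∧ ∀ t ≠ 0, ∀ x, ρ t (ρ s x) = 0 → ρ s x = 0 := by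
  obtain ⟨_, ⟨s, hs, rfl⟩, hmax⟩ := WellFounded.has_min
    (wellFounded_gt : WellFounded ((· > ·) : Submodule R X → Submodule R X → Prop))
    {K | ∃ s : S, s ≠ 0 ∧ LinearMap.ker (ρ s) = K} ⟨_, 1, one_ne_zero, rfl⟩
  refine ⟨s, hs, fun t ht x hx => ?_⟩
  by_contra h
  refine hmax _ ⟨s * t, mul_ne_zero hs ht, rfl⟩ (lt_of_le_of_ne ?_ fun h' => h ?_)
  · intro y hy
    rw [LinearMap.mem_ker] at hy ⊢
    rw [hmul, hy, map_zero]
  · rw [← LinearMap.mem_ker, h', LinearMap.mem_ker, hmul, hx]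

theorem exists_essential_images (ρ : S → X →ₗ[R] X)
    (hmul : ∀ s t x, ρ (s * t) x = ρ t (ρ s x)) :
    ∃ s : S, s ≠ 0 ∧ (∀ t ≠ 0, ∀ x, ρ t (ρ s x) = 0 → ρ s x = 0) ∧
      ∀ p ≠ 0, ∀ W ≤ (criticalSocle R X).map (ρ s),
        Disjoint W ((criticalSocle R X).map (ρ (p * s))) → W = ⊥ := by
  set Y := criticalSocle R X with hY
  obtain ⟨s₀, hs₀, hinj₀⟩ := exists_injective_on_range ρ hmul
  obtain ⟨W, ⟨s, hs, hinj, hW⟩, hmax⟩ := WellFounded.has_min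
    (wellFounded_gt : WellFounded ((· > ·) : Submodule R X → Submodule R X → Prop))
    {W | ∃ s : S, s ≠ 0 ∧ (∀ t ≠ 0, ∀ x, ρ t (ρ s x) = 0 → ρ s x = 0) ∧
      Disjoint W (Y.map (ρ s))} ⟨⊥, s₀, hs₀, hinj₀, disjoint_bot_left⟩
  refine ⟨s, hs, hinj, fun p hp W' hW' hdis => ?_⟩
  by_contra hne
  refine hmax (W ⊔ W') ⟨p * s, mul_ne_zero hp hs, fun t ht x hx => ?_, ?_⟩ ?_
  · rw [hmul] at hx ⊢
    exact hinj t ht _ hx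
  · rw [Submodule.disjoint_def]
    intro x hx hxp
    obtain ⟨w, hw, w', hw', rfl⟩ := Submodule.mem_sup.1 hx
    have hxs : w + w' ∈ Y.map (ρ s) := by
      obtain ⟨y, hy, h⟩ := hxp
      exact ⟨ρ p y, map_mem_criticalSocle _ hy, by rw [← h, hmul]⟩
    have hw0 : w = 0 := by
      refine Submodule.disjoint_def.1 hW w hw ?_
      have : w = (w + w') - w' := by abel
      rw [this]
      exact sub_mem hxs (hW' hw')
    subst hw0
    rw [zero_add] at hxp ⊢
    exact Submodule.disjoint_def.1 hdis _ hw' hxp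
  · refine lt_of_le_of_ne le_sup_left fun h => hne ?_
    have h1 : W' ≤ W := h ▸ le_sup_right
    exact disjoint_self.1 (hW.mono h1 hW')

theorem exists_common_left_multiple (hore : ∀ s t : S, t ≠ 0 → ∃ p q : S, p ≠ 0 ∧ p * s = q * t)
    {s : S} (hs : s ≠ 0) (F : Finset S) (hF : ∀ t ∈ F, t ≠ 0) :
    ∃ w p₀ t₀ : S, t₀ ≠ 0 ∧ w ≠ 0 ∧ w = p₀ * s * t₀ ∧
      ∀ t ∈ F, ∃ p ≠ 0, w = p * s * t := by
  classical
  induction F using Finset.induction_on with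
  | empty => exact ⟨s, 1, 1, one_ne_zero, hs, by simp, by simp⟩
  | insert t F _ ih =>
    obtain ⟨w, p₀, t₀, ht₀, hw, hw₀, hwF⟩ := ih fun u hu => hF u (Finset.mem_insert_of_mem hu)
    have ht : t ≠ 0 := hF t (Finset.mem_insert_self _ _)
    obtain ⟨p, q, hp, hpq⟩ := hore w (s * t) (mul_ne_zero hs ht)
    refine ⟨p * w, p * p₀, t₀, ht₀, mul_ne_zero hp hw, by rw [hw₀]; simp only [mul_assoc], ?_⟩
    intro u hu
    rcases Finset.mem_insert.1 hu with rfl | hu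
    · refine ⟨q, ?_, by rw [hpq, mul_assoc]⟩
      rintro rfl
      rw [zero_mul] at hpq
      exact mul_ne_zero hp hw hpq
    · obtain ⟨p', hp', h⟩ := hwF u hu
      exact ⟨p * p', mul_ne_zero hp hp', by rw [h]; simp only [mul_assoc]⟩

/-- An element lying in every nonzero invariant submodule is torsion-free for the action of a
left Ore domain that acts faithfully on all nonzero invariant submodules. -/
theorem eq_zero_of_mem_invariant_submodules (ρ : S → X →ₗ[R] X)
    (hmul : ∀ s t x, ρ (s * t) x = ρ t (ρ s x))
    (hore : ∀ s t : S, t ≠ 0 → ∃ p q : S, p ≠ 0 ∧ p * s = q * t)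
    (hfaith : ∀ Z : Submodule R X, (∀ s ≠ 0, ∀ z ∈ Z, ρ s z ∈ Z) → Z ≠ ⊥ →
      ∀ s ≠ 0, ∃ z ∈ Z, ρ s z ≠ 0)
    {m : X} (hm : ∀ Z : Submodule R X, (∀ s ≠ 0, ∀ z ∈ Z, ρ s z ∈ Z) → Z ≠ ⊥ → m ∈ Z)
    {a : S} (ha : a ≠ 0) (hma : ρ a m = 0) : m = 0 := by
  by_contra hm0
  have : Nontrivial X := nontrivial_of_ne m 0 hm0
  obtain ⟨s, hs, hinj, hess⟩ := exists_essential_images ρ hmul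
  set Y := criticalSocle R X with hY
  have hYinv : ∀ s, ∀ z ∈ Y, ρ s z ∈ Y := fun s z hz => map_mem_criticalSocle _ hz
  obtain ⟨z, hz, hsz⟩ := hfaith Y (fun s _ => hYinv s) criticalSocle_ne_bot s hs
  let N : {t : S // t ≠ 0} → Submodule R X := fun t => (Y.map (ρ s)).map (ρ t)
  have hmem : m ∈ ⨆ t, N t := by
    refine hm _ (fun u hu x hx => ?_) ?_
    · have : (⨆ t, N t) ≤ (⨆ t, N t).comap (ρ u) := by
        refine iSup_le fun t => ?_
        rintro _ ⟨y, hy, rfl⟩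
        refine Submodule.mem_iSup_of_mem ⟨t * u, mul_ne_zero t.2 hu⟩ ⟨y, hy, ?_⟩
        rw [hmul]
      exact this hx
    · refine (Submodule.ne_bot_iff _).2 ⟨ρ s (ρ s z),
        Submodule.mem_iSup_of_mem ⟨s, hs⟩ ⟨_, ⟨z, hz, rfl⟩, rfl⟩, fun h => hsz (hinj s hs z h)⟩
  obtain ⟨F, hF⟩ := Submodule.mem_iSup_iff_exists_finset.1 hmem
  obtain ⟨w, p₀, t₀, ht₀, hw, hw₀, hwF⟩ := exists_common_left_multiple hore hs
    (F.map (Function.Embedding.subtype _)) (by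
      intro t ht
      obtain ⟨u, _, rfl⟩ := Finset.mem_map.1 ht
      exact u.2)
  have hle : (⨆ t ∈ F, N t) ≤ rationalClosure (Y.map (ρ w)) := by
    refine iSup₂_le fun t ht => ?_
    obtain ⟨p, hp, hwp⟩ := hwF t (Finset.mem_map.2 ⟨t, ht, rfl⟩)
    refine le_rationalClosure_of_essential ?_ ?_ fun V hV hdis => ?_
    · rintro _ ⟨y, hy, rfl⟩
      exact ⟨ρ s (ρ p y), ⟨ρ p y, hYinv p y hy, rfl⟩, by rw [hwp, hmul, hmul]⟩
    · rintro _ ⟨_, ⟨y, hy, rfl⟩, rfl⟩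
      exact hYinv _ _ (hYinv _ _ hy)
    · have h0 : Y.map (ρ s) ⊓ V.comap (ρ t) = ⊥ := by
        refine hess p hp _ inf_le_left ?_
        rw [Submodule.disjoint_def]
        rintro _ ⟨_, hxV⟩ ⟨y, hy, rfl⟩
        rw [hmul]
        refine hinj t t.2 _ (Submodule.disjoint_def.1 hdis _ ?_ ⟨y, hy, ?_⟩)
        · simpa [hmul] using hxV
        · rw [hwp, hmul, hmul]
      refine (Submodule.eq_bot_iff _).2 fun v hv => ?_
      obtain ⟨x, hx, rfl⟩ := hV hv
      have : x ∈ Y.map (ρ s) ⊓ V.comap (ρ t) := ⟨hx, hv⟩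
      rw [h0, Submodule.mem_bot] at this
      rw [this, map_zero]
  refine hm0 (hle hF 1 m fun r hr => ?_)
  obtain ⟨n, _, hn⟩ := hr
  rw [one_smul] at hn
  have h1 : ρ (t₀ * a) (ρ s (ρ p₀ n)) = 0 := by
    rw [hmul, ← hmul s t₀, ← hmul p₀, ← mul_assoc, ← hw₀, hn, map_smul, hma, smul_zero]
  have h2 := hinj _ (mul_ne_zero ht₀ ha) _ h1
  rw [← hn, hw₀, hmul, hmul, h2, map_zero]

end Action

/-- If a simple left Ore domain `S` is Noetherian as a left module over a subring `R`, then its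
proper `R`-`S`-subbimodules are completely prime in the following sense. -/
theorem mem_of_mul_mem_subbimodule {S : Type*} [Ring S] [IsDomain S] [IsSimpleRing S]
    (R : Subring S) [IsNoetherian R S]
    (hore : ∀ s t : S, t ≠ 0 → ∃ p q : S, p ≠ 0 ∧ p * s = q * t)
    (Y : Submodule R S) (hY : ∀ y ∈ Y, ∀ s, y * s ∈ Y)
    {m a : S} (ha : a ≠ 0) (hma : m * a ∈ Y) : m ∈ Y := by
  by_contra hm
  obtain ⟨Y, ⟨hY, m, a, ha, hma, hm⟩, hmax⟩ := WellFounded.has_min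
    (wellFounded_gt : WellFounded ((· > ·) : Submodule R S → Submodule R S → Prop))
    {Y | (∀ y ∈ Y, ∀ s, y * s ∈ Y) ∧ ∃ m a : S, a ≠ 0 ∧ m * a ∈ Y ∧ m ∉ Y}
    ⟨Y, hY, m, a, ha, hma, hm⟩
  let μ : S → S →ₗ[R] S := fun s =>
    { toFun := fun x => x * s
      map_add' := fun x y => add_mul x y s
      map_smul' := fun r x => smul_mul_assoc r x s }
  let ρ : S → (S ⧸ Y) →ₗ[R] (S ⧸ Y) := fun s => Y.mapQ Y (μ s) fun y hy => hY y hy s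
  have hρ : ∀ s x, ρ s (Y.mkQ x) = Y.mkQ (x * s) := fun s x => rfl
  have hcomap : ∀ Z : Submodule R (S ⧸ Y), (∀ s ≠ 0, ∀ z ∈ Z, ρ s z ∈ Z) →
      ∀ y ∈ Z.comap Y.mkQ, ∀ s, y * s ∈ Z.comap Y.mkQ := by
    intro Z hZ y hy s
    by_cases hs : s = 0
    · rw [hs, mul_zero]
      exact zero_mem _
    · exact hZ s hs _ hy
  refine hm ((Submodule.Quotient.mk_eq_zero Y).1 (eq_zero_of_mem_invariant_submodules ρ ?_ hore
    ?_ (m := Y.mkQ m) ?_ ha ?_))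
  · intro s t x
    obtain ⟨x, rfl⟩ := Y.mkQ_surjective x
    rw [hρ, hρ, hρ, mul_assoc]
  · intro Z hZ hne s hs
    by_contra! hzero
    refine hne ?_
    have hZ' := hcomap Z hZ
    let I : TwoSidedIdeal S := TwoSidedIdeal.mk' {s | ∀ z ∈ Z.comap Y.mkQ, z * s ∈ Y}
      (fun z _ => by rw [mul_zero]; exact zero_mem _)
      (fun hx hy z hz => by rw [mul_add]; exact add_mem (hx z hz) (hy z hz))
      (fun hx z hz => by rw [mul_neg]; exact neg_mem (hx z hz))
      (fun {x y} hy z hz => by rw [← mul_assoc]; exact hy _ (hZ' z hz x))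
      (fun {x y} hx z hz => by rw [← mul_assoc]; exact hY _ (hx z hz) y)
    have hI : ∀ x, x ∈ I ↔ ∀ z ∈ Z.comap Y.mkQ, z * x ∈ Y := fun x => by
      simp only [I, TwoSidedIdeal.mem_mk', Set.mem_ofPred_eq]
    have hsI : s ∈ I := (hI s).2 fun z hz => by
      rw [← Submodule.Quotient.mk_eq_zero Y]
      exact hzero _ hz
    have hone : (1 : S) ∈ I := by
      rcases eq_bot_or_eq_top I with h | h
      · rw [h, TwoSidedIdeal.mem_bot] at hsI
        exact absurd hsI hs
      · rw [h]; trivial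
    refine (Submodule.eq_bot_iff _).2 fun z hz => ?_
    obtain ⟨z, rfl⟩ := Y.mkQ_surjective z
    have := (hI 1).1 hone z hz
    rw [mul_one] at this
    exact (Submodule.Quotient.mk_eq_zero Y).2 this
  · intro Z hZ hne
    by_contra hmZ
    have hle : Y ≤ Z.comap Y.mkQ := fun y hy => by
      have : Y.mkQ y = 0 := (Submodule.Quotient.mk_eq_zero Y).2 hy
      rw [Submodule.mem_comap, this]
      exact zero_mem _
    refine hmax (Z.comap Y.mkQ) ⟨hcomap Z hZ, m, a, ha, hle hma, hmZ⟩
      (lt_of_le_of_ne hle fun h => hne ?_)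
    refine (Submodule.eq_bot_iff _).2 fun z hz => ?_
    obtain ⟨z, rfl⟩ := Y.mkQ_surjective z
    refine (Submodule.Quotient.mk_eq_zero Y).2 ?_
    rw [h]
    exact hz
  · rw [hρ]
    exact (Submodule.Quotient.mk_eq_zero Y).2 hma


/-- Let `R ⊆ S` be (not necessarily commutative) Noetherian domains such that `S` is a
simple ring and `S` is finitely generated both as a left and as a right `R`-module.
If `R` and `S` have the same skew field of fractions — i.e. both embed in a division
ring `Q` which is the quotient skew-field of `S`, and every element of `S` is a left
fraction `r₁⁻¹ · r₂` of elements of `R` — then `R = S`. -/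
theorem noetherian_domains_same_fractions_eq
    {S : Type*} [Ring S] [IsDomain S] [IsNoetherianRing S] [IsSimpleRing S]
    (R : Subring S) [IsNoetherianRing R]
    -- `S` is a finitely generated left `R`-module:
    (hleft : ∃ T : Finset S, ∀ s : S,
      s ∈ AddSubgroup.closure {x : S | ∃ r ∈ R, ∃ t ∈ T, x = r * t})
    -- `S` is a finitely generated right `R`-module:
    (hright : ∃ T : Finset S, ∀ s : S,
      s ∈ AddSubgroup.closure {x : S | ∃ t ∈ T, ∃ r ∈ R, x = t * r})
    -- `R` and `S` have the same skew field of fractions: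
    {Q : Type*} [DivisionRing Q] (f : S →+* Q) (hf : Function.Injective f)
    (hQ : ∀ q : Q, ∃ s₁ s₂ : S, s₁ ≠ 0 ∧ q = (f s₁)⁻¹ * f s₂)
    (hfrac : ∀ s : S, ∃ r₁ r₂ : S, r₁ ∈ R ∧ r₂ ∈ R ∧ r₁ ≠ 0 ∧ f s = (f r₁)⁻¹ * f r₂) :
    R = ⊤ := by
  have : Module.Finite R S := by
    obtain ⟨T, hT⟩ := hleft
    refine ⟨⟨T, eq_top_iff.2 fun s _ => ?_⟩⟩
    have hle : AddSubgroup.closure {x : S | ∃ r ∈ R, ∃ t ∈ T, x = r * t} ≤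
        (Submodule.span R (T : Set S)).toAddSubgroup := by
      rw [AddSubgroup.closure_le]
      rintro _ ⟨r, hr, t, ht, rfl⟩
      exact (Submodule.span R (T : Set S)).smul_mem ⟨r, hr⟩ (Submodule.subset_span ht)
    exact hle (hT s)
  have hnoeth : IsNoetherian R S := isNoetherian_of_isNoetherianRing_of_finite R S
  have hore : ∀ s t : S, t ≠ 0 → ∃ p q : S, p ≠ 0 ∧ p * s = q * t := by
    intro s t ht
    obtain ⟨p, q, hp, h⟩ := hQ (f s * (f t)⁻¹)
    refine ⟨p, q, hp, hf ?_⟩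
    have hp' : f p ≠ 0 := (map_ne_zero_iff f hf).2 hp
    have ht' : f t ≠ 0 := (map_ne_zero_iff f hf).2 ht
    rw [map_mul, map_mul, ← mul_inv_cancel_left₀ hp' (f q), ← h, mul_assoc, mul_assoc,
      inv_mul_cancel₀ ht', mul_one]
  have hden : ∀ s : S, ∃ r ∈ R, r ≠ 0 ∧ r * s ∈ R := by
    intro s
    obtain ⟨r₁, r₂, h₁, h₂, h0, h⟩ := hfrac s
    refine ⟨r₁, h₁, h0, ?_⟩
    have : r₁ * s = r₂ := hf (by
      rw [map_mul, h, mul_inv_cancel_left₀ ((map_ne_zero_iff f hf).2 h0)])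
    rwa [this]
  obtain ⟨T, hT⟩ := hright
  obtain ⟨a, ha, haT⟩ : ∃ a : S, a ≠ 0 ∧ ∀ t ∈ T, a * t ∈ R := by
    clear hT
    classical
    induction T using Finset.induction_on with
    | empty => exact ⟨1, one_ne_zero, by simp⟩
    | insert t T _ ih =>
      obtain ⟨a, ha, haT⟩ := ih
      obtain ⟨r, hr, hr0, h⟩ := hden (a * t)
      refine ⟨r * a, mul_ne_zero hr0 ha, fun u hu => ?_⟩
      rw [mul_assoc]
      rcases Finset.mem_insert.1 hu with rfl | hu
      · exact h
      · exact R.mul_mem hr (haT u hu)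
  have haS : ∀ s, a * s ∈ R := by
    intro s
    have hle : AddSubgroup.closure {x : S | ∃ t ∈ T, ∃ r ∈ R, x = t * r} ≤
        R.toAddSubgroup.comap (AddMonoidHom.mulLeft a) := by
      rw [AddSubgroup.closure_le]
      rintro _ ⟨t, ht, r, hr, rfl⟩
      have := R.mul_mem (haT t ht) hr
      rwa [mul_assoc] at this
    exact hle (hT s)
  let Y : Submodule R S :=
    { carrier := {x | ∀ s, x * s ∈ R}
      zero_mem' := fun s => by rw [zero_mul]; exact R.zero_mem
      add_mem' := fun hx hy s => by rw [add_mul]; exact R.add_mem (hx s) (hy s)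
      smul_mem' := fun r x hx s => by
        rw [smul_mul_assoc]
        exact R.mul_mem r.2 (hx s) }
  have hone : (1 : S) ∈ Y := mem_of_mul_mem_subbimodule R hore Y
    (fun y hy s u => by rw [mul_assoc]; exact hy _) ha (by rw [one_mul]; exact haS)
  refine eq_top_iff.2 fun s _ => ?_
  have := hone s
  rwa [one_mul] at this
end

section
/- Let X be an irreducible affine algebraic variety over ℂ whose normalization X̃ is smooth, 𝕂 its function field, and equip 𝒟(𝕂) with the order filtration. Let 𝒫 = 𝒟(X̃, X) be the right ideal of operators mapping ℂ[X̃] into ℂ[X], and ℰ = End_{𝒟(X̃)}(𝒫) identified with { q in the quotient skew-field : q·𝒫 ⊆ 𝒫 }. Then the associated graded spaces satisfy gr 𝒫 ⊂ gr 𝒟(X) ⊆ gr ℰ ⊆ gr 𝒟(X̃) inside gr 𝒟(𝕂). -/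
/-- Differential operators of order at most `n` on a commutative `ℂ`-algebra,
defined inductively. -/
def diffOpOfOrder (K : Type*) [CommRing K] [Algebra ℂ K] : ℕ → Set (Module.End ℂ K)
  | 0 => {u | ∃ b : K, u = LinearMap.mulLeft ℂ b}
  | n + 1 => {u | ∀ b : K,
      u * LinearMap.mulLeft ℂ b - LinearMap.mulLeft ℂ b * u ∈ diffOpOfOrder K n}

/-- The set of all differential operators. -/
def diffOps (K : Type*) [CommRing K] [Algebra ℂ K] : Set (Module.End ℂ K) :=
  {u | ∃ n, u ∈ diffOpOfOrder K n}

/-- Inclusion of associated graded subspaces (with respect to the order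
filtration) of two subsets of `𝒟(𝕂)` : for each `n`, the image of `E ∩ 𝒟_n` in
`𝒟_n/𝒟_{n-1}` is contained in the image of `F ∩ 𝒟_n`. -/
def grLE (K : Type*) [CommRing K] [Algebra ℂ K]
    (E F : Set (Module.End ℂ K)) : Prop :=
  (∀ u ∈ E, u ∈ diffOpOfOrder K 0 → u ∈ F) ∧
  ∀ n : ℕ, ∀ u ∈ E, u ∈ diffOpOfOrder K (n + 1) →
    ∃ w ∈ F, w ∈ diffOpOfOrder K (n + 1) ∧ u - w ∈ diffOpOfOrder K n

open KaehlerDifferential TensorProduct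

section OrderFiltration

variable {K : Type*} [CommRing K] [Algebra ℂ K]

/-- The commutator `u ↦ [u, b]` with multiplication by `b`. -/
noncomputable def commMul : K →ₗ[ℂ] Module.End ℂ (Module.End ℂ K) :=
  LinearMap.mk₂ ℂ (fun b u ↦ u * LinearMap.mulLeft ℂ b - LinearMap.mulLeft ℂ b * u)
    (fun b c u ↦ by ext x; simp [add_mul]; abel)
    (fun t b u ↦ by ext x; simp [smul_sub])
    (fun b u v ↦ by ext x; simp [mul_add]; abel)
    (fun t b u ↦ by ext x; simp [smul_sub])

theorem commMul_apply (b : K) (u : Module.End ℂ K) :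
    commMul b u = u * LinearMap.mulLeft ℂ b - LinearMap.mulLeft ℂ b * u := rfl

theorem commMul_apply_apply (b : K) (u : Module.End ℂ K) (x : K) :
    commMul b u x = u (b * x) - b * u x := rfl

theorem commMul_mul (b : K) (u v : Module.End ℂ K) :
    commMul b (u * v) = commMul b u * v + u * commMul b v := by
  simp only [commMul_apply, sub_mul, mul_sub, mul_assoc]
  abel

theorem commMul_mulLeft (b c : K) : commMul b (LinearMap.mulLeft ℂ c) = 0 := by
  ext x
  simp [commMul_apply_apply]
  ring

theorem commMul_comm (b c : K) (u : Module.End ℂ K) :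
    commMul b (commMul c u) = commMul c (commMul b u) := by
  ext x
  simp only [commMul_apply_apply, mul_left_comm b c]
  ring

theorem commute_commMul (b c : K) : Commute (commMul b) (commMul c) :=
  LinearMap.ext (commMul_comm b c)

variable (K) in
/-- The order filtration, shifted by one: `orderFiltration K (n + 1)` consists of the operators of
order at most `n`. -/
noncomputable def orderFiltration : ℕ → Submodule ℂ (Module.End ℂ K)
  | 0 => ⊥
  | n + 1 => ⨅ b : K, (orderFiltration n).comap (commMul b)

theorem mem_orderFiltration_zero {u : Module.End ℂ K} : u ∈ orderFiltration K 0 ↔ u = 0 := by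
  simp [orderFiltration]

theorem mem_orderFiltration_succ {n : ℕ} {u : Module.End ℂ K} :
    u ∈ orderFiltration K (n + 1) ↔ ∀ b, commMul b u ∈ orderFiltration K n := by
  simp [orderFiltration]

theorem mulLeft_mem_orderFiltration (c : K) :
    LinearMap.mulLeft ℂ c ∈ orderFiltration K 1 := by
  simp [mem_orderFiltration_succ, commMul_mulLeft]

theorem eq_mulLeft_of_mem_orderFiltration_one {u : Module.End ℂ K}
    (hu : u ∈ orderFiltration K 1) : u = LinearMap.mulLeft ℂ (u 1) := by
  ext b
  have h := LinearMap.congr_fun (mem_orderFiltration_zero.1 (mem_orderFiltration_succ.1 hu b)) 1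
  simp only [commMul_apply_apply, mul_one, LinearMap.zero_apply] at h
  rw [LinearMap.mulLeft_apply, sub_eq_zero.1 h, mul_comm]

theorem mem_diffOpOfOrder_iff {n : ℕ} {u : Module.End ℂ K} :
    u ∈ diffOpOfOrder K n ↔ u ∈ orderFiltration K (n + 1) := by
  induction n generalizing u with
  | zero =>
    constructor
    · rintro ⟨b, rfl⟩
      exact mulLeft_mem_orderFiltration b
    · exact fun hu ↦ ⟨u 1, eq_mulLeft_of_mem_orderFiltration_one hu⟩
  | succ n ih =>
    rw [mem_orderFiltration_succ]
    exact forall_congr' fun b ↦ ih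

theorem mul_mem_orderFiltration {m n N : ℕ} (h : m + n ≤ N + 1) {u v : Module.End ℂ K}
    (hu : u ∈ orderFiltration K m) (hv : v ∈ orderFiltration K n) :
    u * v ∈ orderFiltration K N := by
  induction N generalizing m n u v with
  | zero =>
    obtain rfl | rfl : m = 0 ∨ n = 0 := by lia
    · simp [mem_orderFiltration_zero.1 hu]
    · simp [mem_orderFiltration_zero.1 hv]
  | succ N ih =>
    rw [mem_orderFiltration_succ]
    intro b
    rw [commMul_mul]
    refine add_mem ?_ ?_
    · cases m with
      | zero => simp [mem_orderFiltration_zero.1 hu]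
      | succ m => exact ih (by lia) (mem_orderFiltration_succ.1 hu b) hv
    · cases n with
      | zero => simp [mem_orderFiltration_zero.1 hv]
      | succ n => exact ih (by lia) hu (mem_orderFiltration_succ.1 hv b)

theorem mul_mem_diffOps {u v : Module.End ℂ K} (hu : u ∈ diffOps K) (hv : v ∈ diffOps K) :
    u * v ∈ diffOps K := by
  obtain ⟨m, hm⟩ := hu
  obtain ⟨n, hn⟩ := hv
  exact ⟨m + n, mem_diffOpOfOrder_iff.2 <|
    mul_mem_orderFiltration (by lia) (mem_diffOpOfOrder_iff.1 hm) (mem_diffOpOfOrder_iff.1 hn)⟩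

theorem commMul_pow_mem_orderFiltration (b : K) {m n : ℕ} {u : Module.End ℂ K}
    (hu : u ∈ orderFiltration K (n + m)) : (commMul b ^ m) u ∈ orderFiltration K n := by
  induction m generalizing u with
  | zero => simpa using hu
  | succ m ih =>
    rw [pow_succ, Module.End.mul_apply]
    exact ih (mem_orderFiltration_succ.1 hu b)

/-- Principal symbols are multiplicative. -/
theorem commMul_pow_mul (b : K) {m n : ℕ} {u v : Module.End ℂ K}
    (hu : u ∈ orderFiltration K (m + 1)) (hv : v ∈ orderFiltration K (n + 1)) :
    (commMul b ^ (m + n)) (u * v) =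
      (m + n).choose m • ((commMul b ^ m) u * (commMul b ^ n) v) := by
  obtain ⟨N, hN⟩ : ∃ N, m + n = N := ⟨_, rfl⟩
  induction N generalizing m n u v with
  | zero =>
    obtain ⟨rfl, rfl⟩ : m = 0 ∧ n = 0 := by lia
    simp
  | succ N ih =>
    have hub := mem_orderFiltration_succ.1 hu b
    have hvb := mem_orderFiltration_succ.1 hv b
    have step : (commMul b ^ (m + n)) (u * v) =
        (commMul b ^ N) (commMul b u * v) + (commMul b ^ N) (u * commMul b v) := by
      rw [hN, pow_succ, Module.End.mul_apply, commMul_mul, map_add]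
    rw [step]
    rcases m with _ | m <;> rcases n with _ | n
    · lia
    · obtain rfl : 0 + n = N := by lia
      rw [mem_orderFiltration_zero.1 hub, ih hu hvb rfl]
      simp [pow_succ]
    · obtain rfl : m + 0 = N := by lia
      rw [mem_orderFiltration_zero.1 hvb, ih hub hv rfl]
      simp [pow_succ]
    · have h₁ := ih hub hv (by lia)
      have h₂ := ih hu hvb (by lia)
      obtain rfl : m + n + 1 = N := by lia
      rw [← add_assoc] at h₁
      rw [show m + 1 + n = m + n + 1 by lia] at h₂
      rw [h₁, h₂, show m + 1 + (n + 1) = m + n + 1 + 1 by lia,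
        Nat.choose_succ_succ (m + n + 1) m, add_smul, pow_succ _ m, pow_succ _ n]
      rfl

theorem exists_commMul_pow_pow_mul_mulLeft (b c : K) {n : ℕ} {u : Module.End ℂ K}
    (hu : u ∈ orderFiltration K (n + 1)) (k : ℕ) :
    u ^ k * LinearMap.mulLeft ℂ c ∈ orderFiltration K (n * k + 1) ∧
    ∃ N : ℕ, N ≠ 0 ∧ (commMul b ^ (n * k)) (u ^ k * LinearMap.mulLeft ℂ c) =
      N • (((commMul b ^ n) u) ^ k * LinearMap.mulLeft ℂ c) := by
  induction k with
  | zero => exact ⟨by simpa using mulLeft_mem_orderFiltration c, 1, one_ne_zero, by simp⟩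
  | succ k ih =>
    obtain ⟨hmem, N, hN, h⟩ := ih
    rw [pow_succ', mul_assoc, mul_add, mul_one, add_comm (n * k)]
    refine ⟨mul_mem_orderFiltration (by lia) hu hmem,
      (n + n * k).choose n * N, mul_ne_zero (Nat.choose_pos (by lia)).ne' hN, ?_⟩
    rw [commMul_pow_mul b hu hmem, h, mul_smul_comm, smul_smul, pow_succ', mul_assoc]

theorem commMul_pow_apply_mem {A : Subalgebra ℂ K} {u : Module.End ℂ K}
    (hu : ∀ x ∈ A, u x ∈ A) {b : K} (hb : b ∈ A) (n : ℕ) :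
    ∀ x ∈ A, (commMul b ^ n) u x ∈ A := by
  induction n generalizing u with
  | zero => simpa using hu
  | succ n ih =>
    rw [pow_succ, Module.End.mul_apply]
    exact ih fun x hx ↦ sub_mem (hu _ (mul_mem hb hx)) (mul_mem hb (hu x hx))

end OrderFiltration

/-- If all values of a polynomial map lie in a subspace then so do its coefficients. -/
theorem mem_of_forall_sum_pow_smul_mem {k M : Type*} [Field k] [Infinite k] [AddCommGroup M]
    [Module k M] (S : Submodule k M) (N : ℕ) (m : ℕ → M)
    (h : ∀ t : k, ∑ i ∈ Finset.range N, t ^ i • m i ∈ S) {i : ℕ} (hi : i < N) : m i ∈ S := by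
  rw [← Submodule.Quotient.mk_eq_zero S, ← Module.forall_dual_apply_eq_zero_iff k]
  intro φ
  let p : Polynomial k := ∑ i ∈ Finset.range N, Polynomial.monomial i (φ (S.mkQ (m i)))
  have hp : p = 0 := Polynomial.funext fun t ↦ by
    have ht := congrArg φ ((Submodule.Quotient.mk_eq_zero S).2 (h t))
    rw [← Submodule.mkQ_apply, map_sum, map_sum, map_zero] at ht
    simpa [p, Polynomial.eval_finsetSum, mul_comm] using ht
  simpa [p, Polynomial.finsetSum_coeff, Polynomial.coeff_monomial, hi] using
    congrArg (Polynomial.coeff · i) hp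

/-- Polarization of the principal symbol. -/
theorem commMul_pow_commMul_apply_mem {K : Type*} [CommRing K] [Algebra ℂ K]
    {A : Subalgebra ℂ K} {n : ℕ} {u : Module.End ℂ K}
    (h : ∀ b ∈ A, (commMul b ^ (n + 1)) u 1 ∈ A) {b y : K} (hb : b ∈ A) (hy : y ∈ A) :
    (commMul b ^ n) (commMul y u) 1 ∈ A := by
  have key := mem_of_forall_sum_pow_smul_mem (k := ℂ) (Subalgebra.toSubmodule A) (n + 1 + 1)
    (fun i ↦ (n + 1).choose i • (commMul y ^ i * commMul b ^ (n + 1 - i)) u 1)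
    (fun t ↦ by
      have ht := h (t • y + b) (add_mem (A.smul_mem hy t) hb)
      rw [map_add, map_smul, ((commute_commMul y b).smul_left t).add_pow] at ht
      simp only [LinearMap.sum_apply] at ht
      rw [Subalgebra.mem_toSubmodule]
      convert! ht using 2 with i
      rw [← nsmul_eq_mul', smul_pow, smul_mul_assoc]
      simp only [LinearMap.smul_apply]
      rw [smul_comm])
    (i := 1) (by lia)
  simp only [Nat.choose_one_right, pow_one, Nat.add_sub_cancel] at key
  rw [(commute_commMul y b).pow_right n |>.eq, Module.End.mul_apply, ← Nat.cast_smul_eq_nsmul ℂ]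
    at key
  exact ((Subalgebra.toSubmodule A).smul_mem_iff (by exact_mod_cast n.succ_ne_zero)).1 key

section Derivation

/-- A dual basis for the Kähler differentials of a smooth algebra, in terms of derivations. -/
theorem exists_derivation_dual_basis (k A : Type*) [CommRing k] [CommRing A] [Algebra k A]
    [Algebra.Smooth k A] :
    ∃ (s : Finset Ω[A⁄k]) (y : s → A) (δ : s → Derivation k A A),
      ∀ a, D k A a = ∑ i, δ i a • D k A (y i) := by
  have hfg : (Submodule.span A (Set.range (D k A))).FG := by
    rw [span_range_derivation]
    exact Module.Finite.fg_top
  obtain ⟨s, hs, hspan⟩ := Submodule.fg_span_iff_fg_span_finset_subset _ |>.1 hfg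
  rw [span_range_derivation] at hspan
  choose y hy using fun i : s ↦ hs i.2
  let f : (s → A) →ₗ[A] Ω[A⁄k] := Fintype.linearCombination A fun i ↦ (i : Ω[A⁄k])
  have hf : Function.Surjective f := by
    rw [← LinearMap.range_eq_top, Fintype.range_linearCombination, hspan]
    simp
  obtain ⟨g, hg⟩ := Module.projective_lifting_property f LinearMap.id hf
  refine ⟨s, y, fun i ↦ (LinearMap.proj i ∘ₗ g).compDer (D k A), fun a ↦ ?_⟩
  have := LinearMap.congr_fun hg (D k A a)
  simpa [f, Fintype.linearCombination_apply, hy] using this.symm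

theorem derivation_sum_apply {ι k A : Type*} [CommRing k] [CommRing A] [Algebra k A]
    (s : Finset ι) (δ : ι → Derivation k A A) (a : A) : (∑ i ∈ s, δ i) a = ∑ i ∈ s, δ i a :=
  (congrFun (map_sum Derivation.coeFnAddMonoidHom δ s) a).trans (Finset.sum_apply a s _)

/-- A derivation extends to the field of fractions. -/
theorem exists_derivation_extension {k A : Type*} (K : Type*) [CommRing k] [CommRing A]
    [Algebra k A] [Field K] [Algebra k K] [Algebra A K] [IsScalarTower k A K] [IsFractionRing A K]
    (δ : Derivation k A A) :
    ∃ δ' : Derivation k K K, ∀ a, δ' (algebraMap A K a) = algebraMap A K (δ a) := by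
  have := Algebra.FormallyEtale.of_isLocalization (Rₘ := K) (nonZeroDivisors A)
  let l : K ⊗[A] Ω[A⁄k] →ₗ[K] K :=
    LinearMap.liftBaseChange K (Algebra.linearMap A K ∘ₗ δ.liftKaehlerDifferential)
  refine ⟨(l ∘ₗ (tensorKaehlerEquivOfFormallyEtale k A K).symm.toLinearMap).compDer (D k K),
    fun a ↦ ?_⟩
  simp [l, tensorKaehlerEquivOfFormallyEtale_symm_D_algebraMap]

theorem derivation_eq_zero_of_isFractionRing {k A K : Type*} [CommRing k] [CommRing A]
    [Field K] [Algebra k K] [Algebra A K] [IsFractionRing A K]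
    (d : Derivation k K K) (h : ∀ a, d (algebraMap A K a) = 0) : d = 0 := by
  ext x
  obtain ⟨a, b, -, rfl⟩ := IsFractionRing.div_surjective A x
  simp [Derivation.leibniz_div, h]

theorem exists_derivation_dual_basis_fractionRing (k A K : Type*) [CommRing k] [CommRing A]
    [Algebra k A] [Algebra.Smooth k A] [Field K] [Algebra k K] [Algebra A K]
    [IsScalarTower k A K] [IsFractionRing A K] :
    ∃ (s : Finset Ω[A⁄k]) (y : s → A) (δ : s → Derivation k K K),
      (∀ i a, ∃ a', δ i (algebraMap A K a) = algebraMap A K a') ∧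
      ∀ (d : Derivation k K K) (b : K), d b = ∑ i, d (algebraMap A K (y i)) * δ i b := by
  obtain ⟨s, y, δ, h⟩ := exists_derivation_dual_basis k A
  choose δ' hδ' using fun i ↦ exists_derivation_extension K (δ i)
  refine ⟨s, y, δ', fun i a ↦ ⟨_, hδ' i a⟩, fun d b ↦ ?_⟩
  have hd : d - ∑ i, d (algebraMap A K (y i)) • δ' i = 0 := by
    refine derivation_eq_zero_of_isFractionRing (A := A) _ fun a ↦ ?_
    have := congrArg (d.compAlgebraMap A).liftKaehlerDifferential (h a)
    simp only [map_sum, map_smul, Derivation.liftKaehlerDifferential_comp_D] at this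
    simp only [Derivation.sub_apply, derivation_sum_apply, Derivation.smul_apply, hδ', smul_eq_mul,
      sub_eq_zero]
    refine this.trans (Finset.sum_congr rfl fun i _ ↦ ?_)
    rw [Algebra.smul_def, mul_comm]
    rfl
  have := Derivation.congr_fun hd b
  simpa [sub_eq_zero, derivation_sum_apply] using this

end Derivation

section Lift

variable {K : Type*} [Field K] [Algebra ℂ K]

theorem commMul_derivation (δ : Derivation ℂ K K) (b : K) :
    commMul b (δ : K →ₗ[ℂ] K) = LinearMap.mulLeft ℂ (δ b) := by
  ext x
  simp [commMul_apply_apply, mul_comm]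

theorem derivation_mem_orderFiltration (δ : Derivation ℂ K K) :
    (δ : K →ₗ[ℂ] K) ∈ orderFiltration K 2 :=
  mem_orderFiltration_succ.2 fun b ↦ commMul_derivation δ b ▸ mulLeft_mem_orderFiltration _

theorem commMul_eq_sum_of_mem_orderFiltration_two {ι : Type*} [Fintype ι] {y : ι → K}
    {δ : ι → Derivation ℂ K K}
    (h : ∀ (d : Derivation ℂ K K) (b : K), d b = ∑ i, d (y i) * δ i b)
    {u : Module.End ℂ K} (hu : u ∈ orderFiltration K 2) (b : K) :
    commMul b u = ∑ i, commMul (y i) u * LinearMap.mulLeft ℂ (δ i b) := by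
  have hmul (b : K) := eq_mulLeft_of_mem_orderFiltration_one (mem_orderFiltration_succ.1 hu b)
  let d : Derivation ℂ K K := Derivation.mk'
    (LinearMap.applyₗ (1 : K) ∘ₗ commMul.flip u) fun a b ↦ by
      have hab := LinearMap.congr_fun (hmul a) b
      simp only [LinearMap.coe_comp, Function.comp_apply, LinearMap.applyₗ_apply_apply,
        LinearMap.flip_apply, commMul_apply_apply, LinearMap.mulLeft_apply, smul_eq_mul,
        mul_one] at hab ⊢
      linear_combination hab
  have hd (b : K) : commMul b u = LinearMap.mulLeft ℂ (d b) := hmul b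
  ext x
  simp only [hd, LinearMap.sum_apply, Module.End.mul_apply, LinearMap.mulLeft_apply, ← mul_assoc,
    ← Finset.sum_mul]
  rw [h d b]

theorem commMul_sub_sum_mem_orderFiltration {ι : Type*} [Fintype ι] {y : ι → K}
    {δ : ι → Derivation ℂ K K}
    (h : ∀ (d : Derivation ℂ K K) (b : K), d b = ∑ i, d (y i) * δ i b)
    {n : ℕ} {u : Module.End ℂ K} (hu : u ∈ orderFiltration K (n + 2)) (b : K) :
    commMul b u - ∑ i, commMul (y i) u * LinearMap.mulLeft ℂ (δ i b) ∈ orderFiltration K n := by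
  induction n generalizing u with
  | zero =>
    rw [commMul_eq_sum_of_mem_orderFiltration_two h hu, sub_self]
    exact zero_mem _
  | succ n ih =>
    rw [mem_orderFiltration_succ]
    intro c
    convert! ih (mem_orderFiltration_succ.1 hu c) using 1
    simp only [map_sub, map_sum, commMul_mul, commMul_mulLeft, mul_zero, add_zero,
      commMul_comm c]

/-- Euler's identity for principal symbols. -/
theorem smul_sub_sum_mem_orderFiltration {ι : Type*} [Fintype ι] {y : ι → K}
    {δ : ι → Derivation ℂ K K}
    (h : ∀ (d : Derivation ℂ K K) (b : K), d b = ∑ i, d (y i) * δ i b)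
    {n : ℕ} {u : Module.End ℂ K} (hu : u ∈ orderFiltration K (n + 1)) :
    (n : ℂ) • u - ∑ i, commMul (y i) u * (δ i : K →ₗ[ℂ] K) ∈ orderFiltration K n := by
  induction n generalizing u with
  | zero =>
    have (i : ι) := mem_orderFiltration_zero.1 (mem_orderFiltration_succ.1 hu (y i))
    simp [this]
  | succ n ih =>
    rw [mem_orderFiltration_succ]
    intro b
    convert! add_mem (ih (mem_orderFiltration_succ.1 hu b))
      (commMul_sub_sum_mem_orderFiltration h hu b) using 1
    simp only [map_sub, map_sum, map_smul, map_add, commMul_mul, commMul_derivation,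
      Finset.sum_add_distrib, commMul_comm b, Nat.cast_succ, add_smul, one_smul]
    abel

/-- An operator whose symbol takes values in `A` has the symbol of an operator preserving `A`. -/
theorem exists_lift_of_commMul_pow_apply_mem {A : Subalgebra ℂ K} {ι : Type*} [Fintype ι]
    {y : ι → K} {δ : ι → Derivation ℂ K K} (hy : ∀ i, y i ∈ A) (hδ : ∀ i, ∀ a ∈ A, δ i a ∈ A)
    (h : ∀ (d : Derivation ℂ K K) (b : K), d b = ∑ i, d (y i) * δ i b)
    {n : ℕ} {u : Module.End ℂ K} (hu : u ∈ orderFiltration K (n + 1))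
    (hsymb : ∀ b ∈ A, (commMul b ^ n) u 1 ∈ A) :
    ∃ w ∈ orderFiltration K (n + 1), (∀ x ∈ A, w x ∈ A) ∧ u - w ∈ orderFiltration K n := by
  induction n generalizing u with
  | zero =>
    refine ⟨u, hu, fun x hx ↦ ?_, by simp⟩
    rw [eq_mulLeft_of_mem_orderFiltration_one hu]
    exact mul_mem (by simpa using hsymb 0 A.zero_mem) hx
  | succ n ih =>
    choose w hw hwA hwu using fun i ↦ ih (mem_orderFiltration_succ.1 hu (y i))
      fun b hb ↦ commMul_pow_commMul_apply_mem hsymb hb (hy i)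
    have hn : ((n + 1 : ℕ) : ℂ) ≠ 0 := by exact_mod_cast n.succ_ne_zero
    refine ⟨((n + 1 : ℕ) : ℂ)⁻¹ • ∑ i, w i * (δ i : K →ₗ[ℂ] K), ?_, fun x hx ↦ ?_, ?_⟩
    · exact Submodule.smul_mem _ _ <| sum_mem fun i _ ↦
        mul_mem_orderFiltration (by lia) (hw i) (derivation_mem_orderFiltration _)
    · rw [LinearMap.smul_apply, LinearMap.sum_apply]
      exact A.smul_mem (sum_mem fun i _ ↦ hwA i _ (hδ i x hx)) _
    · rw [← Submodule.smul_mem_iff _ hn, smul_sub, smul_inv_smul₀ hn]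
      convert! add_mem (smul_sub_sum_mem_orderFiltration h hu)
        (sum_mem fun i (_ : i ∈ Finset.univ) ↦ mul_mem_orderFiltration (N := n + 1) (by lia)
          (hwu i) (derivation_mem_orderFiltration (δ i))) using 1
      simp only [sub_mul, Finset.sum_sub_distrib]
      abel

theorem commMul_pow_apply_one_isAlmostIntegral {A : Subalgebra ℂ K} {c : K} (hcA : c ∈ A)
    (hc : c ≠ 0) {n : ℕ} {u : Module.End ℂ K} (hu : u ∈ orderFiltration K (n + 1))
    (h : ∀ k, ∀ x ∈ A, (u ^ k * LinearMap.mulLeft ℂ c) x ∈ A) {b : K} (hb : b ∈ A) :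
    IsAlmostIntegral A ((commMul b ^ n) u 1) := by
  refine ⟨⟨c, hcA⟩, mem_nonZeroDivisors_of_ne_zero fun h0 ↦ hc (congrArg Subtype.val h0), fun k ↦ ?_⟩
  obtain ⟨-, N, hN, hk⟩ := exists_commMul_pow_pow_mul_mulLeft b c hu k
  have hmem := commMul_pow_apply_mem (h k) hb (n * k) 1 A.one_mem
  have hs := eq_mulLeft_of_mem_orderFiltration_one
    (commMul_pow_mem_orderFiltration (n := 1) (m := n) b (add_comm n 1 ▸ hu))
  rw [hk, hs, LinearMap.smul_apply, ← Nat.cast_smul_eq_nsmul ℂ] at hmem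
  have hmem' := ((Subalgebra.toSubmodule A).smul_mem_iff (by exact_mod_cast hN)).1 hmem
  rw [LinearMap.pow_mulLeft] at hmem'
  refine ⟨⟨_, hmem'⟩, ?_⟩
  simp [Algebra.smul_def, mul_comm]

end Lift

/-- The conductor of a finite birational extension is nonzero. -/
theorem exists_ne_zero_forall_mul_mem {K : Type*} [Field K] [Algebra ℂ K] (B : Subalgebra ℂ K)
    [IsFractionRing B K] {S : Set K} {T : Finset K}
    (hT : S ⊆ (Submodule.span B (T : Set K) : Set K)) :
    ∃ c ∈ B, c ≠ 0 ∧ ∀ x ∈ S, c * x ∈ B := by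
  obtain ⟨c, hc⟩ := IsLocalization.exist_integer_multiples_of_finset (nonZeroDivisors B) T
  refine ⟨c, (c : B).2, fun h ↦ nonZeroDivisors.coe_ne_zero c (Subtype.ext h), fun x hx ↦ ?_⟩
  have hx' := hT hx
  clear hx
  induction hx' using Submodule.span_induction with
  | mem x hx =>
    obtain ⟨r, hr⟩ := hc x hx
    exact (show (r : K) = (c : B) * x from hr) ▸ r.2
  | zero => simp
  | add x y _ _ hx hy => exact mul_add (c : K) x y ▸ add_mem hx hy
  | smul r x _ hx =>
    rw [Algebra.smul_def, mul_left_comm]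
    exact mul_mem r.2 hx

/-- Let `X` be an irreducible affine variety over `ℂ` whose normalization `X̃` is
smooth, with `ℂ[X] = B ⊆ B̃ = ℂ[X̃] ⊂ 𝕂` and `𝕂` the function field.  Let
`𝒫 = 𝒟(X̃, X)` be the operators mapping `ℂ[X̃]` into `ℂ[X]`, and
`ℰ = End_{𝒟(X̃)}(𝒫) = { q : q·𝒫 ⊆ 𝒫 }`.  Then the associated graded spaces
(for the order filtration) satisfy `gr 𝒫 ⊆ gr 𝒟(X) ⊆ gr ℰ ⊆ gr 𝒟(X̃)`
inside `gr 𝒟(𝕂)`. -/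
theorem graded_inclusions_of_diffops
    {K : Type} [Field K] [Algebra ℂ K]
    (B B' : Subalgebra ℂ K) (hBB' : B ≤ B')
    [IsFractionRing B K] [Algebra.FiniteType ℂ B]
    -- the normalization `X̃` is smooth:
    [Algebra.Smooth ℂ B']
    -- `B'` is the integral closure of `B` in `𝕂`:
    (hB'cl : (B' : Set K) = (integralClosure B K : Set K))
    -- `B'` is a finite `B`-module:
    (hfin : ∃ T : Finset K, (↑T : Set K) ⊆ (B' : Set K) ∧
      (B' : Set K) ⊆ (Submodule.span B (↑T : Set K) : Set K))
    (P DX E DXt : Set (Module.End ℂ K))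
    (hP : P = {u | u ∈ diffOps K ∧ ∀ x ∈ B', u x ∈ B})
    (hDX : DX = {u | u ∈ diffOps K ∧ ∀ x ∈ B, u x ∈ B})
    (hDXt : DXt = {u | u ∈ diffOps K ∧ ∀ x ∈ B', u x ∈ B'})
    (hE : E = {u | u ∈ diffOps K ∧ ∀ p ∈ P, u * p ∈ P}) :
    grLE K P DX ∧ grLE K DX E ∧ grLE K E DXt := by
  subst hP hDX hDXt hE
  have hEDXt {n : ℕ} {u : Module.End ℂ K} (hu : u ∈ orderFiltration K (n + 1))
      (huP : ∀ p ∈ {u | u ∈ diffOps K ∧ ∀ x ∈ B', u x ∈ B},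
        u * p ∈ {u | u ∈ diffOps K ∧ ∀ x ∈ B', u x ∈ B}) :
      ∃ w ∈ orderFiltration K (n + 1), (∀ x ∈ B', w x ∈ B') ∧ u - w ∈ orderFiltration K n := by
    have : IsNoetherianRing B' := Algebra.FiniteType.isNoetherianRing ℂ B'
    have : IsFractionRing B' K := IsFractionRing.of_field _ _ fun z ↦ by
      obtain ⟨a, b, -, rfl⟩ := IsFractionRing.div_surjective B z
      exact ⟨⟨a, hBB' a.2⟩, ⟨b, hBB' b.2⟩, rfl⟩
    obtain ⟨s, y, δ, hδ, h⟩ := exists_derivation_dual_basis_fractionRing ℂ B' K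
    refine exists_lift_of_commMul_pow_apply_mem (fun i ↦ (y i).2) (fun i a ha ↦ ?_) h hu
      fun b hb ↦ ?_
    · obtain ⟨a', ha'⟩ := hδ i ⟨a, ha⟩
      exact (show δ i a = a' from ha') ▸ a'.2
    · obtain ⟨T, -, hT⟩ := hfin
      obtain ⟨c, hcB, hc, hcx⟩ := exists_ne_zero_forall_mul_mem B hT
      have hpow (k : ℕ) : u ^ k * LinearMap.mulLeft ℂ c ∈
          {u | u ∈ diffOps K ∧ ∀ x ∈ B', u x ∈ B} := by
        induction k with
        | zero => exact ⟨⟨0, c, by simp⟩, by simpa using hcx⟩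
        | succ k ih =>
          rw [pow_succ', mul_assoc]
          exact huP _ ih
      have hint := (commMul_pow_apply_one_isAlmostIntegral (hBB' hcB) hc hu
        (fun k x hx ↦ hBB' ((hpow k).2 x hx)) hb).isIntegral
      let _ : Algebra B B' := (Subalgebra.inclusion hBB').toAlgebra
      have : IsScalarTower B B' K := .of_algebraMap_eq fun _ ↦ rfl
      have : Algebra.IsIntegral B B' := ⟨fun x ↦ by
        have hx : IsIntegral B (x : K) := hB'cl.le x.2
        exact (isIntegral_algebraMap_iff (FaithfulSMul.algebraMap_injective B' K)).1 hx⟩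
      exact hB'cl.ge (isIntegral_trans (R := B) _ hint)
  refine ⟨⟨fun u hu _ ↦ ⟨hu.1, fun x hx ↦ hu.2 x (hBB' hx)⟩, fun n u hu hun ↦
      ⟨u, ⟨hu.1, fun x hx ↦ hu.2 x (hBB' hx)⟩, hun, ?_⟩⟩,
    ⟨fun u hu _ ↦ ⟨hu.1, fun p hp ↦ ⟨mul_mem_diffOps hu.1 hp.1, fun x hx ↦ hu.2 _ (hp.2 x hx)⟩⟩,
      fun n u hu hun ↦ ⟨u, ⟨hu.1, fun p hp ↦
        ⟨mul_mem_diffOps hu.1 hp.1, fun x hx ↦ hu.2 _ (hp.2 x hx)⟩⟩, hun, ?_⟩⟩,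
    fun u hu hu0 ↦ ?_, fun n u hu hun ↦ ?_⟩
  · rw [sub_self, mem_diffOpOfOrder_iff]
    exact zero_mem _
  · rw [sub_self, mem_diffOpOfOrder_iff]
    exact zero_mem _
  · obtain ⟨w, -, hwB, huw⟩ := hEDXt (mem_diffOpOfOrder_iff.1 hu0) hu.2
    rw [mem_orderFiltration_zero, sub_eq_zero] at huw
    exact ⟨hu.1, huw ▸ hwB⟩
  · obtain ⟨w, hw, hwB, huw⟩ := hEDXt (mem_diffOpOfOrder_iff.1 hun) hu.2
    have hw' := mem_diffOpOfOrder_iff.2 hw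
    exact ⟨w, ⟨⟨_, hw'⟩, hwB⟩, hw', mem_diffOpOfOrder_iff.2 huw⟩
end
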